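/- Let n, m ≥ 1 be integers and let k = (k_1,…,k_n) be a weight vector. For an m×n real matrix M, one has M ∈ Bad*(k,m,n) if and only if its transpose L = M^T belongs to Bad(k,n,m). -/

import Mathlib

/-- Distance from a real number to the nearest integer. -/
noncomputable def dni (x : ℝ) : ℝ := |x - round x|

/-- Supremum norm of an integer vector, as a real number. -/
noncomputable def snorm {d : ℕ} (q : Fin d → ℤ) : ℝ := ⨆ i, |(q i : ℝ)|

/-- Euclidean norm of an integer vector. -/
noncomputable def enorm {d : ℕ} (u : Fin d → ℤ) : ℝ := Real.sqrt (∑ j, ((u j : ℝ)) ^ 2)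

/-- `L ∈ Bad(k, n, m)`:  inf over nonzero integer vectors `q` of
`max_j |q|_∞^{m k_j} ‖L_j(q)‖` is positive. -/
def badForm {n m : ℕ} (k : Fin n → ℝ) (L : Matrix (Fin n) (Fin m) ℝ) : Prop :=
  ∃ ε > (0 : ℝ), ∀ q : Fin m → ℤ, q ≠ 0 →
    ∃ j : Fin n, ε ≤ snorm q ^ ((m : ℝ) * k j) * dni (∑ i, (q i : ℝ) * L j i)

/-- The twisted set `Bad_L(k, n, m) ⊆ [0,1)^n`. -/
def badTwisted {n m : ℕ} (k : Fin n → ℝ) (L : Matrix (Fin n) (Fin m) ℝ) :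
    Set (Fin n → ℝ) :=
  {α | (∀ j, α j ∈ Set.Ico (0 : ℝ) 1) ∧ ∃ ε > (0 : ℝ), ∀ q : Fin m → ℤ, q ≠ 0 →
    ∃ j : Fin n, ε ≤ snorm q ^ ((m : ℝ) * k j) * dni ((∑ i, (q i : ℝ) * L j i) - α j)}

/-- `M ∈ Bad*(k, m, n)`: inf over nonzero integer vectors `u ∈ ℤⁿ` of
`max_i (max_j |u_j|^{1/(m k_j)}) ‖M_i(u)‖` is positive. -/
def badDual {n m : ℕ} (k : Fin n → ℝ) (M : Matrix (Fin m) (Fin n) ℝ) : Prop :=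
  ∃ ε > (0 : ℝ), ∀ u : Fin n → ℤ, u ≠ 0 →
    ∃ i : Fin m,
      ε ≤ (⨆ j, |(u j : ℝ)| ^ (1 / ((m : ℝ) * k j))) * dni (∑ j, (u j : ℝ) * M i j)

open Matrix MeasureTheory in
/-- Minkowski's theorem for systems of linear forms (strict version). -/
theorem minkowski_forms {ι : Type} [Fintype ι] [DecidableEq ι] (A : Matrix ι ι ℝ)
    (hA : A.det ≠ 0) (c : ι → ℝ) (hc : ∀ i, 0 < c i) (h : |A.det| < ∏ i, c i) :
    ∃ y : ι → ℤ, y ≠ 0 ∧ ∀ i, |(A *ᵥ (fun l => (y l : ℝ))) i| < c i := by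
  set S : Set (ι → ℝ) := (Matrix.toLin' A) ⁻¹' (Set.univ.pi fun i => Set.Ioo (-(c i)) (c i))
    with hS
  have hmem : ∀ x, x ∈ S ↔ ∀ i, |(A *ᵥ x) i| < c i := by
    intro x
    simp [hS, abs_lt]
  have hdet : LinearMap.det (Matrix.toLin' A) ≠ 0 := by
    rwa [LinearMap.det_toLin']
  have hvol : volume S = ENNReal.ofReal (|A.det|⁻¹ * ∏ i, (2 * c i)) := by
    rw [hS, Measure.addHaar_preimage_linearMap _ hdet, volume_pi, Measure.pi_pi,
      LinearMap.det_toLin', abs_inv, ENNReal.ofReal_mul (by positivity),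
      ENNReal.ofReal_prod_of_nonneg (fun i _ => by have := hc i; positivity)]
    congr 1
    refine Finset.prod_congr rfl fun i _ => ?_
    rw [Real.volume_Ioo]
    congr 1
    ring
  have hfd : volume (ZSpan.fundamentalDomain (Pi.basisFun ℝ ι)) = 1 := by
    rw [ZSpan.fundamentalDomain_pi_basisFun, volume_pi, Measure.pi_pi]
    simp
  have hcount : Countable (Submodule.span ℤ (Set.range (Pi.basisFun ℝ ι))).toAddSubgroup :=
    inferInstanceAs (Countable (Submodule.span ℤ (Set.range (Pi.basisFun ℝ ι))))
  obtain ⟨x, hx0, hxS⟩ :=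
    exists_ne_zero_mem_lattice_of_measure_mul_two_pow_lt_measure (s := S)
      (ZSpan.isAddFundamentalDomain' (Pi.basisFun ℝ ι) volume)
      (by
        intro x hx
        rw [hmem] at hx ⊢
        intro i
        rw [Matrix.mulVec_neg, Pi.neg_apply, abs_neg]
        exact hx i)
      ((convex_pi fun i _ => convex_Ioo _ _).linear_preimage _)
      (by
        rw [hfd, hvol, one_mul, Module.finrank_fintype_fun_eq_card]
        rw [show (2 : ENNReal) ^ Fintype.card ι = ENNReal.ofReal (2 ^ Fintype.card ι) by
          rw [ENNReal.ofReal_pow (by norm_num)]; simp]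
        have hd : 0 < |A.det| := abs_pos.mpr hA
        rw [ENNReal.ofReal_lt_ofReal_iff_of_nonneg (by positivity), Finset.prod_mul_distrib,
          Finset.prod_const, Finset.card_univ, inv_mul_eq_div, lt_div_iff₀ hd]
        exact mul_lt_mul_of_pos_left h (by positivity))
  have hz : ∀ i, ∃ z : ℤ, (z : ℝ) = (x : ι → ℝ) i := by
    intro i
    have := ((Pi.basisFun ℝ ι).mem_span_iff_repr_mem ℤ (x : ι → ℝ)).mp x.2 i
    simpa using this
  choose y hy using hz
  have hyx : (fun l => (y l : ℝ)) = (x : ι → ℝ) := funext hy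
  refine ⟨y, ?_, ?_⟩
  · rintro rfl
    apply hx0
    apply Subtype.ext
    rw [← hyx]
    ext; simp
  · rw [hyx]
    exact (hmem _).mp hxS

open Matrix in
/-- Mahler's transference principle. -/
theorem mahler_transfer {ι : Type} [Fintype ι] [DecidableEq ι] [Nonempty ι] (F G : Matrix ι ι ℝ)
    (hF : F.det ≠ 0) (hG : |G.det| = 1)
    (hint : ∀ x y : ι → ℤ, ∃ z : ℤ,
      (F *ᵥ (fun l => (x l : ℝ))) ⬝ᵥ (G *ᵥ (fun l => (y l : ℝ))) = z)
    (t : ι → ℝ) (ht : ∀ i, 0 < t i) (hprod : ∏ i, t i = 1) (η : ℝ) (hη : 0 < η)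
    (x : ι → ℤ) (hx : x ≠ 0)
    (hxs : ∀ i, |(F *ᵥ (fun l => (x l : ℝ))) i|
      < (η / Fintype.card ι) ^ (Fintype.card ι - 1) * t i) :
    ∃ y : ι → ℤ, y ≠ 0 ∧ ∀ i, |(G *ᵥ (fun l => (y l : ℝ))) i| ≤ η / t i := by
  set f := F *ᵥ (fun l => (x l : ℝ)) with hf
  have hd : (0 : ℝ) < Fintype.card ι := by exact_mod_cast Fintype.card_pos
  set θ := η / Fintype.card ι with hθ
  have hθp : 0 < θ := by positivity
  have hf0 : f ≠ 0 := by
    intro h0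
    have := Matrix.eq_zero_of_mulVec_eq_zero hF h0
    apply hx
    ext l
    have := congrFun this l
    simpa using this
  obtain ⟨i0, hi0⟩ := Finite.exists_max (fun i => |f i| / t i)
  have hμ : 0 < |f i0| / t i0 := by
    obtain ⟨i, hi⟩ := Function.ne_iff.mp hf0
    exact lt_of_lt_of_le (div_pos (abs_pos.mpr hi) (ht i)) (hi0 i)
  have hfi0 : 0 < |f i0| := by
    have := mul_pos hμ (ht i0)
    rwa [div_mul_cancel₀ _ (ht i0).ne'] at this
  set A := G.updateRow i0 (∑ l, f l • G l) with hA
  have hdetA : |A.det| = |f i0| := by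
    rw [hA, Matrix.det_updateRow_sum, smul_eq_mul, abs_mul, hG, mul_one]
  set c : ι → ℝ := Function.update (fun i => θ / t i) i0 1 with hc
  have hcprod : ∏ i, c i = θ ^ (Fintype.card ι - 1) * t i0 := by
    rw [hc, Finset.prod_update_of_mem (Finset.mem_univ _), one_mul, Finset.prod_div_distrib,
      Finset.prod_const, ← Finset.erase_eq, Finset.card_erase_of_mem (Finset.mem_univ _), Finset.card_univ]
    have h1 := Finset.mul_prod_erase Finset.univ t (Finset.mem_univ i0)
    rw [hprod] at h1
    have hne : (∏ i ∈ Finset.univ.erase i0, t i) ≠ 0 :=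
      Finset.prod_ne_zero_iff.mpr fun i _ => (ht i).ne'
    rw [div_eq_iff hne, mul_assoc, h1, mul_one]
  obtain ⟨y, hy0, hy⟩ := minkowski_forms A (by
      rw [← abs_pos, hdetA]; exact hfi0) c (by
      intro i
      rw [hc, Function.update_apply]
      split_ifs
      · exact one_pos
      · exact div_pos hθp (ht i)) (by rw [hdetA, hcprod]; exact hxs i0)
  refine ⟨y, hy0, ?_⟩
  set g := G *ᵥ (fun l => (y l : ℝ)) with hg
  have hgi : ∀ i, i ≠ i0 → |g i| < θ / t i := by
    intro i hi
    have := hy i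
    rw [hc, Function.update_of_ne hi] at this
    have e : (A *ᵥ (fun l => (y l : ℝ))) i = g i := by
      simp [hg, hA, Matrix.mulVec, Matrix.updateRow_ne hi]
    rwa [e] at this
  have hΦ : |f ⬝ᵥ g| < 1 := by
    have := hy i0
    rw [hc, Function.update_self] at this
    have e : (A *ᵥ (fun l => (y l : ℝ))) i0 = f ⬝ᵥ g := by
      rw [Matrix.mulVec, hA, Matrix.updateRow_self, sum_dotProduct, dotProduct]
      exact Finset.sum_congr rfl fun i _ => by
        rw [smul_dotProduct]; rfl
    rwa [e] at this
  have hΦ0 : f ⬝ᵥ g = 0 := by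
    obtain ⟨z, hz⟩ := hint x y
    rw [← hf, ← hg] at hz
    rw [hz] at hΦ ⊢
    have : |z| < 1 := by exact_mod_cast hΦ
    rw [Int.abs_lt_one_iff.mp this]; simp
  have hθη : θ ≤ η := by
    rw [hθ]
    exact div_le_self hη.le (by exact_mod_cast Fintype.card_pos)
  intro i
  by_cases hi : i = i0
  · subst hi
    rw [dotProduct, ← Finset.add_sum_erase _ _ (Finset.mem_univ i)] at hΦ0
    have h1 : f i * g i = -∑ l ∈ Finset.univ.erase i, f l * g l := by linarith
    have h2 : |f i| * |g i| ≤ ∑ l ∈ Finset.univ.erase i, (|f i| / t i) * θ := by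
      rw [← abs_mul, h1, abs_neg]
      refine (Finset.abs_sum_le_sum_abs _ _).trans (Finset.sum_le_sum fun l hl => ?_)
      have hl' := Finset.ne_of_mem_erase hl
      rw [abs_mul]
      have ha : |f l| ≤ (|f i| / t i) * t l := (div_le_iff₀ (ht l)).mp (hi0 l)
      have hb := (hgi l hl').le
      calc |f l| * |g l| ≤ ((|f i| / t i) * t l) * (θ / t l) :=
            mul_le_mul ha hb (abs_nonneg _) (mul_nonneg hμ.le (ht l).le)
        _ = (|f i| / t i) * θ := by
            have := (ht l).ne'
            field_simp
    have h3 : ∑ l ∈ Finset.univ.erase i, (|f i| / t i) * θ ≤ (|f i| / t i) * η := by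
      rw [Finset.sum_const, nsmul_eq_mul]
      have : ((Finset.univ.erase i).card : ℝ) ≤ Fintype.card ι := by
        exact_mod_cast Finset.card_le_univ _
      calc ((Finset.univ.erase i).card : ℝ) * (|f i| / t i * θ)
          ≤ Fintype.card ι * (|f i| / t i * θ) :=
            mul_le_mul_of_nonneg_right this (by positivity)
        _ = (|f i| / t i) * η := by
            rw [hθ]; field_simp
    have h4 : |f i| * |g i| ≤ |f i| * (η / t i) := by
      refine (h2.trans h3).trans (le_of_eq ?_)
      ring
    exact le_of_mul_le_mul_left h4 hfi0
  · exact (hgi i hi).le.trans (div_le_div_of_nonneg_right hθη (ht i).le)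

/-- The matrix of the forms `p_i - M_i(u)`, `u_j`. -/
noncomputable def matF {n m : ℕ} (M : Matrix (Fin m) (Fin n) ℝ) :
    Matrix (Fin m ⊕ Fin n) (Fin m ⊕ Fin n) ℝ := Matrix.fromBlocks 1 (-M) 0 1

/-- The matrix of the forms `q_i`, `L_j(q) - r_j`. -/
noncomputable def matG {n m : ℕ} (M : Matrix (Fin m) (Fin n) ℝ) :
    Matrix (Fin m ⊕ Fin n) (Fin m ⊕ Fin n) ℝ := Matrix.fromBlocks 1 0 M.transpose (-1)

open Matrix

theorem matF_inl {n m : ℕ} (M : Matrix (Fin m) (Fin n) ℝ) (x : Fin m ⊕ Fin n → ℝ) (i : Fin m) :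
    (matF M *ᵥ x) (Sum.inl i) = x (Sum.inl i) - ∑ j, x (Sum.inr j) * M i j := by
  simp [matF, sub_eq_add_neg, Matrix.mulVec,
    dotProduct, mul_comm, Matrix.one_apply]

theorem matF_inr {n m : ℕ} (M : Matrix (Fin m) (Fin n) ℝ) (x : Fin m ⊕ Fin n → ℝ) (j : Fin n) :
    (matF M *ᵥ x) (Sum.inr j) = x (Sum.inr j) := by
  simp [matF, Matrix.fromBlocks_mulVec]

theorem matG_inl {n m : ℕ} (M : Matrix (Fin m) (Fin n) ℝ) (x : Fin m ⊕ Fin n → ℝ) (i : Fin m) :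
    (matG M *ᵥ x) (Sum.inl i) = x (Sum.inl i) := by
  simp [matG, Matrix.fromBlocks_mulVec]

theorem matG_inr {n m : ℕ} (M : Matrix (Fin m) (Fin n) ℝ) (x : Fin m ⊕ Fin n → ℝ) (j : Fin n) :
    (matG M *ᵥ x) (Sum.inr j) = (∑ i, x (Sum.inl i) * M.transpose j i) - x (Sum.inr j) := by
  simp [matG, sub_eq_add_neg, Matrix.mulVec,
    dotProduct, mul_comm, Matrix.one_apply]

theorem matF_det {n m : ℕ} (M : Matrix (Fin m) (Fin n) ℝ) : |(matF M).det| = 1 := by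
  simp [matF]

theorem matG_det {n m : ℕ} (M : Matrix (Fin m) (Fin n) ℝ) : |(matG M).det| = 1 := by
  simp [matG, Matrix.det_neg]

theorem matFG_int {n m : ℕ} (M : Matrix (Fin m) (Fin n) ℝ) (x y : Fin m ⊕ Fin n → ℤ) :
    ∃ z : ℤ, (matF M *ᵥ (fun l => (x l : ℝ))) ⬝ᵥ (matG M *ᵥ (fun l => (y l : ℝ))) = z := by
  refine ⟨(∑ i, x (Sum.inl i) * y (Sum.inl i)) - ∑ j, x (Sum.inr j) * y (Sum.inr j), ?_⟩
  rw [dotProduct, Fintype.sum_sum_type]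
  simp only [matF_inl, matF_inr, matG_inl, matG_inr, sub_mul, mul_sub, Finset.sum_sub_distrib,
    Finset.sum_mul, Finset.mul_sum]
  rw [Finset.sum_comm]
  push_cast
  have : ∀ (i : Fin n) (j : Fin m), (x (Sum.inr i) : ℝ) * M j i * (y (Sum.inl j) : ℝ)
      = (x (Sum.inr i) : ℝ) * ((y (Sum.inl j) : ℝ) * M.transpose i j) := by
    intro i j
    rw [Matrix.transpose_apply]; ring
  simp only [this]
  ring

theorem snorm_ge {d : ℕ} (q : Fin d → ℤ) (i : Fin d) : |(q i : ℝ)| ≤ snorm q :=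
  le_ciSup (f := fun i => |(q i : ℝ)|) (Set.finite_range _).bddAbove i

theorem one_le_abs_cast {z : ℤ} (h : z ≠ 0) : (1 : ℝ) ≤ |(z : ℝ)| := by
  exact_mod_cast Int.one_le_abs h

theorem eq_zero_of_abs_cast_lt {z : ℤ} (h : |(z : ℝ)| < 1) : z = 0 := by
  by_contra h0
  exact absurd (one_le_abs_cast h0) (not_le.mpr h)

theorem dni_nonneg (x : ℝ) : 0 ≤ dni x := abs_nonneg _

theorem dni_le (x : ℝ) (z : ℤ) : dni x ≤ |x - z| := round_le x z

theorem weight_prod {n m : ℕ} (k : Fin n → ℝ) (hksum : ∑ j, k j = 1) (V : ℝ) (hV : 0 < V) :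
    (∏ j, V ^ ((m : ℝ) * k j)) = V ^ m := by
  rw [← Real.rpow_sum_of_pos hV, ← Finset.mul_sum, hksum, mul_one, Real.rpow_natCast]

/-- The constant used in Mahler's transference. -/
noncomputable def sconst (n m : ℕ) (η : ℝ) : ℝ :=
  (η / Fintype.card (Fin m ⊕ Fin n)) ^ (Fintype.card (Fin m ⊕ Fin n) - 1)

theorem dual_of_form (n m : ℕ) (hn : 0 < n) (hm : 0 < m)
    (k : Fin n → ℝ) (hk : ∀ j, 0 < k j) (hksum : ∑ j, k j = 1)
    (M : Matrix (Fin m) (Fin n) ℝ) (h : badForm k M.transpose) : badDual k M := by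
  haveI : Nonempty (Fin n) := ⟨⟨0, hn⟩⟩
  haveI : Nonempty (Fin m) := ⟨⟨0, hm⟩⟩
  have hmk : ∀ j, 0 < (m : ℝ) * k j := fun j => mul_pos (by exact_mod_cast hm) (hk j)
  obtain ⟨ε, hε, hbad⟩ := h
  obtain ⟨η, hη, hη1, hηε⟩ : ∃ η : ℝ, 0 < η ∧ η < 1 ∧ η < ε :=
    ⟨min 1 ε / 2, by positivity, by have := min_le_left 1 ε; linarith,
      by have := min_le_right 1 ε; have : 0 < min 1 ε := by positivity
         linarith⟩
  set s := sconst n m η with hs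
  have hsp : 0 < s := by
    rw [hs, sconst]
    have : (0 : ℝ) < Fintype.card (Fin m ⊕ Fin n) := by exact_mod_cast Fintype.card_pos
    positivity
  obtain ⟨A, hA1, hA⟩ : ∃ A : ℝ, 1 ≤ A ∧ ∀ j, 1 / s < A ^ ((m : ℝ) * k j) := by
    have h1 : ∀ᶠ A : ℝ in Filter.atTop, ∀ j, 1 / s < A ^ ((m : ℝ) * k j) :=
      Filter.eventually_all.mpr fun j => (tendsto_rpow_atTop (hmk j)).eventually_gt_atTop _
    exact ((Filter.eventually_ge_atTop 1).and h1).exists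
  have hA0 : 0 < A := by linarith
  refine ⟨s / A, by positivity, fun u hu => ?_⟩
  by_contra! hcon
  set U : ℝ := ⨆ j, |(u j : ℝ)| ^ (1 / ((m : ℝ) * k j)) with hU
  have hUge : ∀ j, |(u j : ℝ)| ^ (1 / ((m : ℝ) * k j)) ≤ U := fun j =>
    le_ciSup (f := fun j => |(u j : ℝ)| ^ (1 / ((m : ℝ) * k j))) (Set.finite_range _).bddAbove j
  have hU1 : 1 ≤ U := by
    obtain ⟨j, hj⟩ := Function.ne_iff.mp hu
    exact (Real.one_le_rpow (one_le_abs_cast hj) (by have := hmk j; positivity)).trans (hUge j)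
  have hU0 : 0 < U := by linarith
  have huj : ∀ j, |(u j : ℝ)| ≤ U ^ ((m : ℝ) * k j) := by
    intro j
    have := Real.rpow_le_rpow (by positivity) (hUge j) (hmk j).le
    rwa [← Real.rpow_mul (abs_nonneg _), one_div_mul_cancel (hmk j).ne', Real.rpow_one] at this
  set V := A * U with hV
  have hV0 : 0 < V := by positivity
  have hV1 : 1 ≤ V := one_le_mul_of_one_le_of_one_le hA1 hU1
  set t : Fin m ⊕ Fin n → ℝ := Sum.elim (fun _ => V⁻¹) (fun j => V ^ ((m : ℝ) * k j)) with ht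
  set x : Fin m ⊕ Fin n → ℤ := Sum.elim (fun i => round (∑ j, (u j : ℝ) * M i j)) u with hx
  obtain ⟨y, hy0, hy⟩ := mahler_transfer (matF M) (matG M)
    (by rw [← abs_pos, matF_det]; exact one_pos) (matG_det M) (matFG_int M) t
    (by rintro (i | j) <;> simp only [ht, Sum.elim_inl, Sum.elim_inr] <;> positivity)
    (by
      rw [Fintype.prod_sum_type]
      simp only [ht, Sum.elim_inl, Sum.elim_inr, Finset.prod_const, Finset.card_univ,
        Fintype.card_fin]
      rw [weight_prod k hksum V hV0, inv_pow, inv_mul_cancel₀ (by positivity)])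
    η hη x
    (by
      intro h0
      apply hu
      ext j
      have := congrFun h0 (Sum.inr j)
      simpa [hx] using this)
    (by
      change ∀ i, _ < s * t i
      rintro (i | j)
      · rw [matF_inl]
        simp only [hx, ht, Sum.elim_inl, Sum.elim_inr]
        rw [abs_sub_comm]
        change dni _ < _
        have h1 := hcon i
        rw [hV, ← div_eq_mul_inv, ← div_div, lt_div_iff₀ hU0, mul_comm]
        exact h1
      · rw [matF_inr]
        simp only [hx, ht, Sum.elim_inr]
        refine (huj j).trans_lt ?_
        rw [hV, Real.mul_rpow hA0.le hU0.le, ← mul_assoc]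
        have h1 := hA j
        rw [div_lt_iff₀ hsp] at h1
        have h2 : 0 < U ^ ((m : ℝ) * k j) := by positivity
        nlinarith)
  have hyl : ∀ i, |(y (Sum.inl i) : ℝ)| ≤ η * V := by
    intro i
    have := hy (Sum.inl i)
    rw [matG_inl] at this
    simpa [ht] using this
  have hyr : ∀ j, |(∑ i, (y (Sum.inl i) : ℝ) * M.transpose j i) - y (Sum.inr j)|
      ≤ η / V ^ ((m : ℝ) * k j) := by
    intro j
    have := hy (Sum.inr j)
    rw [matG_inr] at this
    simpa only [ht, Sum.elim_inr] using this
  have hVj : ∀ j, 1 ≤ V ^ ((m : ℝ) * k j) := fun j => Real.one_le_rpow hV1 (hmk j).le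
  have hq : (fun i => y (Sum.inl i)) ≠ 0 := by
    intro h0
    have h0' : ∀ i, y (Sum.inl i) = 0 := fun i => congrFun h0 i
    apply hy0
    ext (i | j)
    · exact h0' i
    · apply eq_zero_of_abs_cast_lt
      have h1 := hyr j
      simp only [h0', Int.cast_zero, zero_mul, Finset.sum_const_zero, zero_sub, abs_neg] at h1
      exact h1.trans_lt ((div_le_self hη.le (hVj j)).trans_lt hη1)
  obtain ⟨j, hj⟩ := hbad _ hq
  have hsn : snorm (fun i => y (Sum.inl i)) ≤ V :=
    ciSup_le fun i => (hyl i).trans (by nlinarith)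
  have hsn0 : 0 ≤ snorm (fun i => y (Sum.inl i)) := Real.iSup_nonneg fun i => abs_nonneg _
  have h1 : snorm (fun i => y (Sum.inl i)) ^ ((m : ℝ) * k j) ≤ V ^ ((m : ℝ) * k j) :=
    Real.rpow_le_rpow hsn0 hsn (hmk j).le
  have h2 := (dni_le _ _).trans (hyr j)
  have h3 := mul_le_mul h1 h2 (dni_nonneg _) (by positivity)
  rw [mul_div_cancel₀ _ (by have := hVj j; positivity)] at h3
  linarith

theorem form_of_dual (n m : ℕ) (hn : 0 < n) (hm : 0 < m)
    (k : Fin n → ℝ) (hk : ∀ j, 0 < k j) (hksum : ∑ j, k j = 1)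
    (M : Matrix (Fin m) (Fin n) ℝ) (h : badDual k M) : badForm k M.transpose := by
  haveI : Nonempty (Fin n) := ⟨⟨0, hn⟩⟩
  haveI : Nonempty (Fin m) := ⟨⟨0, hm⟩⟩
  have hm0 : (0 : ℝ) < m := by exact_mod_cast hm
  have hmk : ∀ j, 0 < (m : ℝ) * k j := fun j => mul_pos hm0 (hk j)
  have hk1 : ∀ j, k j ≤ 1 := fun j => by
    rw [← hksum]
    exact Finset.single_le_sum (f := k) (fun i _ => (hk i).le) (Finset.mem_univ j)
  obtain ⟨ε, hε, hbad⟩ := h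
  obtain ⟨η, hη, hη1, hηε⟩ : ∃ η : ℝ, 0 < η ∧ η < 1 ∧ η < ε :=
    ⟨min 1 ε / 2, by positivity, by have := min_le_left 1 ε; linarith,
      by have := min_le_right 1 ε; have : 0 < min 1 ε := by positivity
         linarith⟩
  set s := sconst n m η with hs
  have hsp : 0 < s := by
    rw [hs, sconst]
    have : (0 : ℝ) < Fintype.card (Fin m ⊕ Fin n) := by exact_mod_cast Fintype.card_pos
    positivity
  obtain ⟨A, hA1, hA⟩ : ∃ A : ℝ, 1 ≤ A ∧ 1 / s < A :=
    ((Filter.eventually_ge_atTop 1).and (Filter.eventually_gt_atTop (1 / s))).exists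
  have hA0 : 0 < A := by linarith
  refine ⟨s / A ^ m, by positivity, fun q hq => ?_⟩
  by_contra! hcon
  set Q : ℝ := snorm q with hQ
  have hQ1 : 1 ≤ Q := by
    obtain ⟨i, hi⟩ := Function.ne_iff.mp hq
    exact (one_le_abs_cast hi).trans (snorm_ge q i)
  have hQ0 : 0 < Q := by linarith
  set V := A * Q with hV
  have hV0 : 0 < V := by positivity
  have hV1 : 1 ≤ V := one_le_mul_of_one_le_of_one_le hA1 hQ1
  set t : Fin m ⊕ Fin n → ℝ := Sum.elim (fun _ => V) (fun j => (V ^ ((m : ℝ) * k j))⁻¹) with ht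
  set x : Fin m ⊕ Fin n → ℤ :=
    Sum.elim q (fun j => round (∑ i, (q i : ℝ) * M.transpose j i)) with hx
  obtain ⟨y, hy0, hy⟩ := mahler_transfer (matG M) (matF M)
    (by rw [← abs_pos, matG_det]; exact one_pos) (matF_det M)
    (fun x y => by
      obtain ⟨z, hz⟩ := matFG_int M y x
      exact ⟨z, by rw [dotProduct_comm]; exact hz⟩) t
    (by rintro (i | j) <;> simp only [ht, Sum.elim_inl, Sum.elim_inr] <;> positivity)
    (by
      rw [Fintype.prod_sum_type]
      simp only [ht, Sum.elim_inl, Sum.elim_inr, Finset.prod_const, Finset.card_univ,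
        Fintype.card_fin, Finset.prod_inv_distrib]
      rw [weight_prod k hksum V hV0, mul_inv_cancel₀ (by positivity)])
    η hη x
    (by
      intro h0
      apply hq
      ext i
      have := congrFun h0 (Sum.inl i)
      simpa [hx] using this)
    (by
      change ∀ i, _ < s * t i
      rintro (i | j)
      · rw [matG_inl]
        simp only [hx, ht, Sum.elim_inl]
        refine (snorm_ge q i).trans_lt ?_
        rw [hV, ← hQ, ← mul_assoc]
        rw [div_lt_iff₀ hsp] at hA
        nlinarith
      · rw [matG_inr]
        simp only [hx, ht, Sum.elim_inl, Sum.elim_inr]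
        change dni _ < _
        have h1 := hcon j
        have h2 : A ^ ((m : ℝ) * k j) ≤ A ^ m := by
          rw [← Real.rpow_natCast]
          exact Real.rpow_le_rpow_of_exponent_le hA1
            (mul_le_of_le_one_right hm0.le (hk1 j))
        have h3 : 0 < A ^ ((m : ℝ) * k j) := by positivity
        have h4 : 0 < Q ^ ((m : ℝ) * k j) := by positivity
        have h5 : s / A ^ m ≤ s / A ^ ((m : ℝ) * k j) := div_le_div_of_nonneg_left hsp.le h3 h2
        rw [hV, Real.mul_rpow hA0.le hQ0.le, ← div_eq_mul_inv, ← div_div, lt_div_iff₀ h4, mul_comm]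
        exact h1.trans_le h5)
  have hVj : ∀ j, 1 ≤ V ^ ((m : ℝ) * k j) := fun j => Real.one_le_rpow hV1 (hmk j).le
  have hyl : ∀ i, |(∑ j, (y (Sum.inr j) : ℝ) * M i j) - y (Sum.inl i)| ≤ η / V := by
    intro i
    have := hy (Sum.inl i)
    rw [matF_inl, abs_sub_comm] at this
    simpa only [ht, Sum.elim_inl] using this
  have hyr : ∀ j, |(y (Sum.inr j) : ℝ)| ≤ η * V ^ ((m : ℝ) * k j) := by
    intro j
    have := hy (Sum.inr j)
    rw [matF_inr] at this
    simpa only [ht, Sum.elim_inr, div_inv_eq_mul] using this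
  have hu : (fun j => y (Sum.inr j)) ≠ 0 := by
    intro h0
    have h0' : ∀ j, y (Sum.inr j) = 0 := fun j => congrFun h0 j
    apply hy0
    ext (i | j)
    · apply eq_zero_of_abs_cast_lt
      have h1 := hyl i
      simp only [h0', Int.cast_zero, zero_mul, Finset.sum_const_zero, zero_sub, abs_neg] at h1
      exact h1.trans_lt ((div_le_self hη.le hV1).trans_lt hη1)
    · exact h0' j
  obtain ⟨i, hi⟩ := hbad _ hu
  have h1 : (⨆ j, |(y (Sum.inr j) : ℝ)| ^ (1 / ((m : ℝ) * k j))) ≤ V := by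
    refine ciSup_le fun j => ?_
    have h2 : |(y (Sum.inr j) : ℝ)| ≤ V ^ ((m : ℝ) * k j) :=
      (hyr j).trans (by have := hVj j; nlinarith)
    have h3 := Real.rpow_le_rpow (abs_nonneg _) h2 (one_div_pos.mpr (hmk j)).le
    rwa [← Real.rpow_mul hV0.le, mul_one_div_cancel (hmk j).ne', Real.rpow_one] at h3
  have h2 := (dni_le _ _).trans (hyl i)
  have h3 := mul_le_mul h1 h2 (dni_nonneg _) hV0.le
  rw [mul_div_cancel₀ _ hV0.ne'] at h3
  linarith

/-- **transference.** An `m × n` matrix `M` belongs to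
`Bad*(k, m, n)` if and only if its transpose belongs to `Bad(k, n, m)`. -/
theorem badDual_iff_badForm_transpose (n m : ℕ) (hn : 0 < n) (hm : 0 < m)
    (k : Fin n → ℝ) (hk : ∀ j, 0 < k j) (hksum : ∑ j, k j = 1)
    (M : Matrix (Fin m) (Fin n) ℝ) :
    badDual k M ↔ badForm k M.transpose :=
  ⟨form_of_dual n m hn hm k hk hksum M, dual_of_form n m hn hm k hk hksum M⟩
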